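/- Over a field of characteristic 2, the Lie superalgebra pe(k) preserving the non-degenerate odd symmetric form Π_{k|k} consists of supermatrices [[A, C],[D, Aᵀ]] with A ∈ gl(k) and C, D symmetric k×k matrices; it is closed under the superbracket and the squaring of odd elements. Its superdimension is k² | k(k+1). -/

import Mathlib

open Matrix

/-- The symmetric matrix whose entries are given by a function on unordered pairs. -/
def symmMatrix {n R : Type*} (f : Sym2 n → R) : Matrix n n R :=
  Matrix.of fun i j => f s(i, j)

theorem symmMatrix_transpose {n R : Type*} (f : Sym2 n → R) :
    (symmMatrix f)ᵀ = symmMatrix f := by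
  ext i j
  simp [symmMatrix, Sym2.eq_swap]

theorem symmMatrix_injective {n R : Type*} :
    Function.Injective (symmMatrix : (Sym2 n → R) → Matrix n n R) := by
  intro f g h
  ext z
  induction z with
  | _ i j => exact congrFun (congrFun h i) j

theorem exists_symmMatrix_eq {n R : Type*} {C : Matrix n n R} (hC : Cᵀ = C) :
    ∃ f : Sym2 n → R, symmMatrix f = C :=
  ⟨Sym2.lift ⟨fun i j => C i j, fun i j => congrFun (congrFun hC.symm i) j⟩, rfl⟩

theorem mem_skewAdjoint_iff_fromBlocks {n K : Type*} [Fintype n] [DecidableEq n]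
    [CommRing K] [CharP K 2] (X : Matrix (n ⊕ n) (n ⊕ n) K) :
    X ∈ skewAdjointMatricesLieSubalgebra
        (Matrix.fromBlocks 0 (1 : Matrix n n K) (1 : Matrix n n K) 0) ↔
      ∃ A C D : Matrix n n K, Cᵀ = C ∧ Dᵀ = D ∧ X = Matrix.fromBlocks A C D Aᵀ := by
  have neg_eq (M : Matrix n n K) : -M = M := by
    ext i j
    exact CharTwo.neg_eq (M i j)
  rw [mem_skewAdjointMatricesLieSubalgebra, mem_skewAdjointMatricesSubmodule,
    Matrix.IsSkewAdjoint, Matrix.IsAdjointPair]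
  constructor
  · intro h
    obtain ⟨A, C, D, E, rfl⟩ : ∃ A C D E, X = Matrix.fromBlocks A C D E :=
      ⟨_, _, _, _, (Matrix.fromBlocks_toBlocks X).symm⟩
    simp only [Matrix.fromBlocks_transpose, Matrix.fromBlocks_neg, Matrix.fromBlocks_multiply,
      Matrix.fromBlocks_inj, neg_eq, mul_zero, mul_one, zero_mul, one_mul, zero_add,
      add_zero] at h
    obtain ⟨hD, hE, -, hC⟩ := h
    exact ⟨A, C, D, hC, hD, by rw [hE]⟩
  · rintro ⟨A, C, D, hC, hD, rfl⟩
    simp [Matrix.fromBlocks_transpose, Matrix.fromBlocks_neg, Matrix.fromBlocks_multiply,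
      neg_eq, hC, hD]

/-- The linear map sending a matrix and a pair of symmetric matrices to the supermatrix
`[[A, C], [D, Aᵀ]]`. -/
def periplecticMap (n K : Type*) [CommRing K] :
    (Matrix n n K × (Sym2 n → K) × (Sym2 n → K)) →ₗ[K] Matrix (n ⊕ n) (n ⊕ n) K where
  toFun p := Matrix.fromBlocks p.1 (symmMatrix p.2.1) (symmMatrix p.2.2) p.1ᵀ
  map_add' p q := by
    rw [Matrix.fromBlocks_add]
    rfl
  map_smul' c p := by
    rw [RingHom.id_apply, Matrix.fromBlocks_smul]
    rfl

theorem periplecticMap_injective (n K : Type*) [CommRing K] :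
    Function.Injective (periplecticMap n K) := by
  rintro ⟨A, f, g⟩ ⟨A', f', g'⟩ h
  obtain ⟨hA, hf, hg, -⟩ := Matrix.fromBlocks_inj.mp h
  exact Prod.ext hA (Prod.ext (symmMatrix_injective hf) (symmMatrix_injective hg))

theorem range_periplecticMap (n K : Type*) [Fintype n] [DecidableEq n]
    [CommRing K] [CharP K 2] :
    LinearMap.range (periplecticMap n K) =
      skewAdjointMatricesSubmodule
        (Matrix.fromBlocks 0 (1 : Matrix n n K) (1 : Matrix n n K) 0) := by
  ext X
  rw [← mem_skewAdjointMatricesLieSubalgebra, mem_skewAdjoint_iff_fromBlocks]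
  constructor
  · rintro ⟨⟨A, f, g⟩, rfl⟩
    exact ⟨A, _, _, symmMatrix_transpose f, symmMatrix_transpose g, rfl⟩
  · rintro ⟨A, C, D, hC, hD, rfl⟩
    obtain ⟨f, rfl⟩ := exists_symmMatrix_eq hC
    obtain ⟨g, rfl⟩ := exists_symmMatrix_eq hD
    exact ⟨(A, f, g), rfl⟩

/-- Over a field of characteristic 2, the periplectic Lie superalgebra `pe(k)`
preserving the non-degenerate odd symmetric form `Π_{k|k}` consists exactly of the
supermatrices `[[A, C],[D, Aᵀ]]` with `C`, `D` symmetric; it is closed under the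
squaring of odd elements; and its superdimension is `k² | k(k+1)`. -/
theorem periplectic_description
    (K : Type*) [Field K] [CharP K 2] (k : ℕ) :
    (∀ X : Matrix (Fin k ⊕ Fin k) (Fin k ⊕ Fin k) K,
      X ∈ skewAdjointMatricesLieSubalgebra
            (Matrix.fromBlocks 0 (1 : Matrix (Fin k) (Fin k) K)
              (1 : Matrix (Fin k) (Fin k) K) 0) ↔
      ∃ A C D : Matrix (Fin k) (Fin k) K,
        Cᵀ = C ∧ Dᵀ = D ∧ X = Matrix.fromBlocks A C D Aᵀ) ∧
    (∀ X : Matrix (Fin k ⊕ Fin k) (Fin k ⊕ Fin k) K,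
      X ∈ skewAdjointMatricesLieSubalgebra
            (Matrix.fromBlocks 0 (1 : Matrix (Fin k) (Fin k) K)
              (1 : Matrix (Fin k) (Fin k) K) 0) →
      X.toBlocks₁₁ = 0 → X.toBlocks₂₂ = 0 →
      X * X ∈ skewAdjointMatricesLieSubalgebra
            (Matrix.fromBlocks 0 (1 : Matrix (Fin k) (Fin k) K)
              (1 : Matrix (Fin k) (Fin k) K) 0)) ∧
    Module.finrank K
        ↥(skewAdjointMatricesLieSubalgebra
            (Matrix.fromBlocks 0 (1 : Matrix (Fin k) (Fin k) K)
              (1 : Matrix (Fin k) (Fin k) K) 0))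
      = k * k + k * (k + 1) := by
  refine ⟨mem_skewAdjoint_iff_fromBlocks, fun X hX h₁ h₂ => ?_, ?_⟩
  · rw [mem_skewAdjoint_iff_fromBlocks] at hX ⊢
    obtain ⟨A, C, D, hC, hD, rfl⟩ := hX
    rw [Matrix.toBlocks_fromBlocks₁₁] at h₁
    subst h₁
    exact ⟨C * D, 0, 0, by simp, by simp, by
      simp [Matrix.fromBlocks_multiply, Matrix.transpose_mul, hC, hD]⟩
  · change Module.finrank K (skewAdjointMatricesSubmodule
      (Matrix.fromBlocks 0 (1 : Matrix (Fin k) (Fin k) K) 1 0)) = _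
    rw [← range_periplecticMap, LinearMap.finrank_range_of_inj (periplecticMap_injective _ K),
      Module.finrank_prod, Module.finrank_prod, Module.finrank_matrix,
      Module.finrank_fintype_fun_eq_card, Module.finrank_self, Sym2.card, Fintype.card_fin,
      ← two_mul, Nat.choose_two_right, Nat.add_sub_cancel,
      Nat.mul_div_cancel' (mul_comm k (k + 1) ▸ (Nat.even_mul_succ_self k).two_dvd)]
    ring
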